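/- arXiv:1302.0424 — 4 statements merged into one kernel-verified Lean document; each statement's English description precedes it below -/
import Mathlib

section
/- Let T₁, …, T_d be pairwise commuting self-adjoint endomorphisms of a nonzero finite-dimensional complex inner product space H. Let Σ(T₁, …, T_d) ⊆ ℝ^d be the set of all tuples (trace(T₁Q), …, trace(T_dQ)) where Q ranges over positive semidefinite self-adjoint endomorphisms of H with trace(Q) = 1. Then Σ(T₁, …, T_d) equals the convex hull of JointSpec(T₁, …, T_d). -/
noncomputable section

/-- The joint spectrum of a family of (commuting self-adjoint) endomorphisms:
the set of `λ ∈ ℝ^d` admitting a common nonzero eigenvector. -/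
def jointSpec {H : Type*} [NormedAddCommGroup H] [InnerProductSpace ℂ H]
    {d : ℕ} (T : Fin d → H →L[ℂ] H) : Set (EuclideanSpace ℝ (Fin d)) :=
  {x | ∃ v : H, v ≠ 0 ∧ ∀ j, T j v = (x j : ℂ) • v}

/-- The image `Σ(T₁,…,T_d)` of the expectation map: all tuples
`(trace (T₁ Q), …, trace (T_d Q))` over mixed quantum states `Q`
(positive semidefinite self-adjoint endomorphisms of trace `1`). -/
def expectationSet {H : Type*} [NormedAddCommGroup H] [InnerProductSpace ℂ H]
    [FiniteDimensional ℂ H] {d : ℕ} (T : Fin d → H →L[ℂ] H) :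
    Set (EuclideanSpace ℝ (Fin d)) :=
  {x | ∃ Q : H →L[ℂ] H, Q.IsPositive ∧
      LinearMap.trace ℂ H (Q : H →ₗ[ℂ] H) = 1 ∧
      ∀ j, (x j : ℂ) = LinearMap.trace ℂ H (((T j).comp Q : H →L[ℂ] H) : H →ₗ[ℂ] H)}

open Module.End in
theorem exists_joint_basis {H : Type*} [NormedAddCommGroup H] [InnerProductSpace ℂ H]
    [FiniteDimensional ℂ H]
    {d : ℕ} (T : Fin d → H →L[ℂ] H)
    (hsa : ∀ j, IsSelfAdjoint (T j))
    (hcomm : ∀ j k, Commute (T j) (T k)) :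
    ∃ (b : OrthonormalBasis (Fin (Module.finrank ℂ H)) ℂ H)
      (l : Fin (Module.finrank ℂ H) → EuclideanSpace ℝ (Fin d)),
      ∀ i j, T j (b i) = (l i j : ℂ) • b i := by
  classical
  have hS : ∀ j, ((T j : H →ₗ[ℂ] H)).IsSymmetric := fun j => (hsa j).isSymmetric
  have hC : Pairwise (Function.onFun Commute fun j => (T j : H →ₗ[ℂ] H)) := by
    intro j k _
    have h := hcomm j k
    change (T j : H →ₗ[ℂ] H) * (T k : H →ₗ[ℂ] H) = (T k : H →ₗ[ℂ] H) * (T j : H →ₗ[ℂ] H)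
    ext v
    exact congrArg (fun A : H →L[ℂ] H => A v) h.eq
  have hI := LinearMap.IsSymmetric.directSum_isInternal_of_pairwise_commute hS hC
  have hO := LinearMap.IsSymmetric.orthogonalFamily_iInf_eigenspaces hS
  have hfin : Finite {α : Fin d → ℂ // (⨅ j, eigenspace (T j : H →ₗ[ℂ] H) (α j)) ≠ ⊥} :=
    WellFoundedGT.finite_ne_bot_of_iSupIndep hI.submodule_iSupIndep
  have := Fintype.ofFinite {α : Fin d → ℂ // (⨅ j, eigenspace (T j : H →ₗ[ℂ] H) (α j)) ≠ ⊥}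
  have hI' := (DirectSum.isInternal_ne_bot_iff).2 hI
  have hO' := hO.comp (Subtype.val_injective
    (p := fun α : Fin d → ℂ => (⨅ j, eigenspace (T j : H →ₗ[ℂ] H) (α j)) ≠ ⊥))
  let b := hI'.subordinateOrthonormalBasis rfl hO'
  have hb : ∀ i, ∃ x : EuclideanSpace ℝ (Fin d), ∀ j, T j (b i) = (x j : ℂ) • b i := by
    intro i
    have hi := hI'.subordinateOrthonormalBasis_subordinate rfl i hO'
    set α := (hI'.subordinateOrthonormalBasisIndex rfl i hO').1
    have hm : ∀ j, T j (b i) = α j • b i := by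
      intro j
      exact mem_eigenspace_iff.1 ((Submodule.mem_iInf _).1 hi j)
    have hne : b i ≠ 0 := b.orthonormal.ne_zero i
    refine ⟨WithLp.toLp 2 fun j => (α j).re, fun j => ?_⟩
    have hev : HasEigenvalue (T j : H →ₗ[ℂ] H) (α j) :=
      hasEigenvalue_of_hasEigenvector ⟨mem_eigenspace_iff.2 (hm j), hne⟩
    have := (hS j).conj_eigenvalue_eq_self hev
    rw [hm j]
    congr 1
    exact (Complex.conj_eq_iff_re.1 this).symm
  choose l hl using hb
  exact ⟨b, l, hl⟩

/-- For commuting self-adjoint operators, the image of the expectation map is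
the convex hull of the joint spectrum. -/
theorem stmt9 {H : Type*} [NormedAddCommGroup H] [InnerProductSpace ℂ H]
    [FiniteDimensional ℂ H] [Nontrivial H]
    {d : ℕ} (T : Fin d → H →L[ℂ] H)
    (hsa : ∀ j, IsSelfAdjoint (T j))
    (hcomm : ∀ j k, Commute (T j) (T k)) :
    expectationSet T = convexHull ℝ (jointSpec T) := by
  apply Set.Subset.antisymm
  · rintro x ⟨Q, hQ, htr, hx⟩
    obtain ⟨b, l, hl⟩ := exists_joint_basis T hsa hcomm
    have hre : ∀ i, ((inner ℂ (b i) (Q (b i))).re : ℂ) = inner ℂ (b i) (Q (b i)) := fun i =>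
      Complex.ext (by simp) (by
        simpa using (Complex.nonneg_iff.1 (hQ.inner_nonneg_right (b i))).2)
    have hxx : x = ∑ i, (inner ℂ (b i) (Q (b i))).re • l i := by
      ext j
      apply Complex.ofReal_injective
      rw [hx j, ContinuousLinearMap.toLinearMap_comp, LinearMap.trace_comp_comm',
        LinearMap.trace_eq_sum_inner _ b]
      simp only [LinearMap.comp_apply, ContinuousLinearMap.coe_coe, hl, map_smul,
        inner_smul_right]
      simp [hre, mul_comm]
    rw [hxx]
    refine (convex_convexHull ℝ _).sum_mem (fun i _ => ?_) ?_ (fun i _ => subset_convexHull ℝ _ ?_)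
    · exact (Complex.nonneg_iff.1 (hQ.inner_nonneg_right (b i))).1
    · apply Complex.ofReal_injective
      rw [LinearMap.trace_eq_sum_inner _ b] at htr
      simpa [hre] using htr
    · exact ⟨b i, b.orthonormal.ne_zero i, hl i⟩
  · apply convexHull_min
    · rintro x ⟨v, hv, hx⟩
      have hn : ((‖v‖ : ℂ)) ≠ 0 := by simpa using hv
      set w : H := ((‖v‖ : ℂ)⁻¹) • v with hw
      have hw1 : inner ℂ w w = 1 := by
        have : ‖w‖ = 1 := by
          rw [hw, norm_smul]; simp [hv]
        simp [inner_self_eq_norm_sq_to_K, this]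
      have hTw : ∀ j, T j w = (x j : ℂ) • w := by
        intro j
        rw [hw, map_smul, hx, smul_comm]
      refine ⟨InnerProductSpace.rankOne ℂ w w, ?_, ?_, fun j => ?_⟩
      · exact InnerProductSpace.isPositive_rankOne_self w
      · rw [InnerProductSpace.trace_rankOne, hw1]
      · have : (T j).comp (InnerProductSpace.rankOne ℂ w w)
            = (x j : ℂ) • InnerProductSpace.rankOne ℂ w w := by
          ext u
          simp [hTw]
          rw [smul_comm]
        rw [this, ContinuousLinearMap.toLinearMap_smul, map_smul,
          InnerProductSpace.trace_rankOne, hw1]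
        simp
    · rintro x ⟨P, hP, hPt, hPx⟩ y ⟨Q, hQ, hQt, hQy⟩ a c ha hc hac
      have hac' : (a : ℂ) + c = 1 := by exact_mod_cast hac
      refine ⟨(a : ℂ) • P + (c : ℂ) • Q, ?_, ?_, fun j => ?_⟩
      · exact (hP.smul_of_nonneg (by exact_mod_cast ha)).add
          (hQ.smul_of_nonneg (by exact_mod_cast hc))
      · simp [hPt, hQt, hac']
      · simp only [ContinuousLinearMap.comp_add, ContinuousLinearMap.comp_smul,
          ContinuousLinearMap.toLinearMap_add, ContinuousLinearMap.toLinearMap_smul, map_add,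
          map_smul, ← hPx, ← hQy]
        simp
end
end

section
/- Let V : [0, ∞) → ℝ be a smooth function with V(0) = 0 and V(r) > 0, V'(r) > 0, V''(r) ≥ 0 for all r > 0. Define g(z) := sup_{r ≥ 0} (r z − r V(r)) for z ≥ 0 (this supremum is finite). Then g(0) = 0, g(z) > 0 for every z > 0, and the function z ↦ √(g(z)) is concave on (0, ∞). -/
noncomputable section

/-- Properties of the Legendre transform `g` of `r ↦ r V(r)` for a smooth
potential `V` on `[0,∞)` with `V(0) = 0`, `V > 0`, `V' > 0`, `V'' ≥ 0` on
`(0,∞)`: `g(0) = 0`, `g > 0` on `(0,∞)`, and `√g` is concave on `(0,∞)`. -/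
theorem stmt15 (V : ℝ → ℝ) (hV : ContDiffOn ℝ (⊤ : ℕ∞) V (Set.Ici 0))
    (hV0 : V 0 = 0)
    (hVpos : ∀ r > (0:ℝ), 0 < V r)
    (hV' : ∀ r > (0:ℝ), 0 < deriv V r)
    (hV'' : ∀ r > (0:ℝ), 0 ≤ deriv (deriv V) r)
    (g : ℝ → ℝ)
    (hg : ∀ z, g z = sSup ((fun r => r * z - r * V r) '' Set.Ici 0)) :
    (∀ z ≥ (0:ℝ), BddAbove ((fun r => r * z - r * V r) '' Set.Ici 0)) ∧
      g 0 = 0 ∧ (∀ z > (0:ℝ), 0 < g z) ∧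
      ConcaveOn ℝ (Set.Ioi 0) (fun z => Real.sqrt (g z)) := by
  have hcont : ContinuousOn V (Set.Ici 0) := hV.continuousOn
  have hsm : ContDiffOn ℝ (⊤ : ℕ∞) V (Set.Ioi 0) := hV.mono Set.Ioi_subset_Ici_self
  have hd1 : ContDiffOn ℝ 1 (deriv V) (Set.Ioi 0) :=
    ((contDiffOn_infty_iff_deriv_of_isOpen isOpen_Ioi).1 hsm).2.of_le
      (by exact_mod_cast le_top)
  have hconv : ConvexOn ℝ (Set.Ici 0) V := by
    apply convexOn_of_deriv2_nonneg (convex_Ici 0) hcont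
    · rw [interior_Ici]
      exact hsm.differentiableOn (by simp)
    · rw [interior_Ici]
      exact hd1.differentiableOn (by simp)
    · intro x hx
      rw [interior_Ici] at hx
      exact hV'' x hx
  have h1 : 0 < V 1 := hVpos 1 one_pos
  have hle : ∀ t : ℝ, 0 ≤ t → t ≤ 1 → ∀ r : ℝ, 0 ≤ r → V (t * r) ≤ t * V r := by
    intro t ht ht1 r hr
    have := hconv.2 (x := r) (y := 0) hr (Set.mem_Ici.2 le_rfl) ht (sub_nonneg.2 ht1) (by ring)
    simpa [hV0] using this
  have hmax : ∀ z ≥ (0:ℝ), ∃ r ≥ (0:ℝ), ∀ s ≥ (0:ℝ), s * z - s * V s ≤ r * z - r * V r := by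
    intro z hz
    set R := 1 + z / V 1 with hR
    have hR0 : 0 ≤ R := by positivity
    have hzR : 0 ≤ z / V 1 := by positivity
    have hc : ContinuousOn (fun r => r * z - r * V r) (Set.Icc 0 R) := by
      have := hcont.mono (Set.Icc_subset_Ici_self : Set.Icc (0:ℝ) R ⊆ _)
      fun_prop
    obtain ⟨r, hr, hrm⟩ := isCompact_Icc.exists_isMaxOn (Set.nonempty_Icc.2 hR0) hc
    refine ⟨r, hr.1, fun s hs => ?_⟩
    by_cases hsR : s ≤ R
    · exact hrm (Set.mem_Icc.2 ⟨hs, hsR⟩)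
    · push Not at hsR
      have h0 := hrm (Set.mem_Icc.2 ⟨le_rfl, hR0⟩)
      simp only [Set.mem_ofPred_eq, zero_mul, sub_zero] at h0
      have hs1 : 1 ≤ s := by linarith
      have hs0 : 0 < s := by linarith
      have h2 := hle s⁻¹ (by positivity) (inv_le_one_of_one_le₀ hs1) s hs
      rw [inv_mul_cancel₀ hs0.ne'] at h2
      have h3 : s * V 1 ≤ V s := by
        have := mul_le_mul_of_nonneg_left h2 hs
        rwa [mul_inv_cancel_left₀ hs0.ne'] at this
      have h4 : z ≤ s * V 1 := by
        rw [← div_le_iff₀ h1]; linarith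
      nlinarith
  have hbdd : ∀ z ≥ (0:ℝ), BddAbove ((fun r => r * z - r * V r) '' Set.Ici 0) := by
    intro z hz
    obtain ⟨r, hr, hm⟩ := hmax z hz
    refine ⟨r * z - r * V r, ?_⟩
    rintro _ ⟨s, hs, rfl⟩
    exact hm s hs
  have hlb : ∀ z ≥ (0:ℝ), ∀ r ≥ (0:ℝ), r * z - r * V r ≤ g z := by
    intro z hz r hr
    rw [hg]
    exact le_csSup (hbdd z hz) ⟨r, hr, rfl⟩
  have hatt : ∀ z ≥ (0:ℝ), ∃ r ≥ (0:ℝ), g z = r * z - r * V r := by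
    intro z hz
    obtain ⟨r, hr, hm⟩ := hmax z hz
    refine ⟨r, hr, le_antisymm ?_ (hlb z hz r hr)⟩
    rw [hg]
    apply csSup_le (Set.Nonempty.image _ ⟨0, Set.mem_Ici.2 le_rfl⟩)
    rintro _ ⟨s, hs, rfl⟩
    exact hm s hs
  have hpos : ∀ z > (0:ℝ), 0 < g z := by
    intro z hz
    have ht : 0 < z / (z + V 1) := by positivity
    have h2 := hle (z / (z + V 1)) ht.le (by rw [div_le_one (by positivity)]; linarith) 1 zero_le_one
    rw [mul_one] at h2
    have h3 : z / (z + V 1) * V 1 < z := by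
      rw [div_mul_eq_mul_div, div_lt_iff₀ (by positivity)]
      nlinarith
    have h4 := hlb z hz.le _ ht.le
    have h5 : 0 < z / (z + V 1) * (z - V (z / (z + V 1))) := mul_pos ht (by linarith)
    linarith
  refine ⟨hbdd, ?_, hpos, convex_Ioi 0, ?_⟩
  · apply le_antisymm
    · obtain ⟨r, hr, h⟩ := hatt 0 le_rfl
      rcases eq_or_lt_of_le hr with h0 | h0
      · rw [h, ← h0]; simp
      · have := mul_pos h0 (hVpos r h0)
        linarith
    · simpa using hlb 0 le_rfl 0 le_rfl
  · intro x hx y hy a b ha hb hab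
    have hx0 : 0 < x := hx
    have hy0 : 0 < y := hy
    have hz : 0 ≤ a * x + b * y := by positivity
    obtain ⟨r, hr, hgr⟩ := hatt x hx0.le
    obtain ⟨s, hs, hgs⟩ := hatt y hy0.le
    have hpx := hpos x hx0
    have hpy := hpos y hy0
    have hu : 0 < x - V r := by
      by_contra! h
      nlinarith [mul_nonneg hr (neg_nonneg.2 h)]
    have hv : 0 < y - V s := by
      by_contra! h
      nlinarith [mul_nonneg hs (neg_nonneg.2 h)]
    have hc := hconv.2 (x := r) (y := s) hr hs ha hb hab
    have hl := hlb (a * x + b * y) hz (a * r + b * s) (by positivity)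
    simp only [smul_eq_mul] at hc ⊢
    apply Real.le_sqrt_of_sq_le
    have hgx : g x = r * (x - V r) := by rw [hgr]; ring
    have hgy : g y = s * (y - V s) := by rw [hgs]; ring
    rw [hgx, hgy, Real.sqrt_mul hr, Real.sqrt_mul hs]
    have e1 := Real.sq_sqrt hr
    have e2 := Real.sq_sqrt hs
    have e3 := Real.sq_sqrt hu.le
    have e4 := Real.sq_sqrt hv.le
    have hA : (a * r + b * s) * (a * (x - V r) + b * (y - V s)) ≤ g (a * x + b * y) := by
      refine le_trans ?_ hl
      rw [← mul_sub]
      apply mul_le_mul_of_nonneg_left _ (by positivity)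
      linarith
    refine le_trans ?_ hA
    set p := √r
    set q := √s
    set u := √(x - V r)
    set v := √(y - V s)
    rw [← e3, ← e4, ← e1, ← e2]
    nlinarith [mul_nonneg (mul_nonneg ha hb) (sq_nonneg (p * v - q * u))]
end
end

section
/- Let V : [0, ∞) → ℝ be a smooth function with V(0) = 0 and V(r) > 0, V'(r) > 0, V''(r) ≥ 0 for all r > 0. Consider the Hamiltonian H(x, ξ) = (ξ₁² + ξ₂²)/2 + V(x₁² + x₂²) and the angular momentum F(x, ξ) = x₁ξ₂ − x₂ξ₁ on ℝ²(x) × ℝ²(ξ) = ℝ⁴. Then the classical spectrum, i.e. the image of the map ℝ⁴ → ℝ², (x, ξ) ↦ (F(x, ξ), H(x, ξ)), is a convex subset of ℝ². -/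
noncomputable section

lemma convexOn_pot (V : ℝ → ℝ) (hV : ContDiffOn ℝ (⊤ : ℕ∞) V (Set.Ici 0))
    (hV'' : ∀ r > (0:ℝ), 0 ≤ deriv (deriv V) r) : ConvexOn ℝ (Set.Ici 0) V := by
  have hV2 : ContDiffOn ℝ 2 V (Set.Ioi 0) :=
    (hV.mono Set.Ioi_subset_Ici_self).of_le (WithTop.coe_le_coe.2 (le_top : (2 : ℕ∞) ≤ ⊤))
  apply convexOn_of_deriv2_nonneg (convex_Ici 0) hV.continuousOn
  · rw [interior_Ici]
    exact hV2.differentiableOn (by norm_num)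
  · rw [interior_Ici]
    have := ((contDiffOn_succ_iff_deriv_of_isOpen (n := 1) isOpen_Ioi).1 hV2).2.2
    exact this.differentiableOn (by norm_num)
  · intro x hx
    rw [interior_Ici] at hx
    exact hV'' x hx

lemma mem_spec (V : ℝ → ℝ) (p : ℝ × ℝ) :
    p ∈ (Set.range (fun q : ℝ × ℝ × ℝ × ℝ =>
      ((q.1 * q.2.2.2 - q.2.1 * q.2.2.1,
        (q.2.2.1 ^ 2 + q.2.2.2 ^ 2) / 2 + V (q.1 ^ 2 + q.2.1 ^ 2)) : ℝ × ℝ))) ↔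
    ∃ r s : ℝ, 0 ≤ r ∧ 0 ≤ s ∧ p.1 ^ 2 ≤ r * s ∧ p.2 = s / 2 + V r := by
  constructor
  · rintro ⟨⟨a, b, c, d⟩, rfl⟩
    refine ⟨a ^ 2 + b ^ 2, c ^ 2 + d ^ 2, by positivity, by positivity, ?_, rfl⟩
    dsimp only
    nlinarith [sq_nonneg (a * c + b * d)]
  · obtain ⟨f, h⟩ := p
    rintro ⟨r, s, hr, hs, hf, hh⟩
    dsimp only at hf hh
    subst hh
    rcases hr.eq_or_lt with rfl | hr
    · have : f = 0 := by nlinarith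
      subst this
      refine ⟨(0, 0, √s, 0), ?_⟩
      simp [Real.sq_sqrt hs]
    · have h1 : 0 ≤ s - f ^ 2 / r := by
        rw [sub_nonneg, div_le_iff₀ hr]; linarith
      have hq : √r ≠ 0 := (Real.sqrt_pos.2 hr).ne'
      refine ⟨(√r, 0, √(s - f ^ 2 / r), f / √r), ?_⟩
      ext
      · dsimp only
        field_simp
        ring
      · dsimp only
        rw [Real.sq_sqrt h1, div_pow, Real.sq_sqrt hr.le]
        simp

/-- The classical spectrum of a particle in the plane in a rotationally
symmetric potential, i.e. the image of `(x, ξ) ↦ (F(x,ξ), H(x,ξ))` with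
`F = x₁ξ₂ - x₂ξ₁` and `H = (ξ₁² + ξ₂²)/2 + V(x₁² + x₂²)`, is convex. -/
theorem stmt16 (V : ℝ → ℝ) (hV : ContDiffOn ℝ (⊤ : ℕ∞) V (Set.Ici 0))
    (hV0 : V 0 = 0)
    (hVpos : ∀ r > (0:ℝ), 0 < V r)
    (hV' : ∀ r > (0:ℝ), 0 < deriv V r)
    (hV'' : ∀ r > (0:ℝ), 0 ≤ deriv (deriv V) r) :
    Convex ℝ (Set.range (fun q : ℝ × ℝ × ℝ × ℝ =>
      ((q.1 * q.2.2.2 - q.2.1 * q.2.2.1,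
        (q.2.2.1 ^ 2 + q.2.2.2 ^ 2) / 2 + V (q.1 ^ 2 + q.2.1 ^ 2)) : ℝ × ℝ))) := by
  intro p hp q hq a b ha hb hab
  rw [mem_spec] at hp hq ⊢
  obtain ⟨f, h⟩ := p
  obtain ⟨g, k⟩ := q
  obtain ⟨r, s, hr, hs, hf, hh⟩ := hp
  obtain ⟨t, u, ht, hu, hg, hk⟩ := hq
  have hc := (convexOn_pot V hV hV'').2 hr ht ha hb hab
  simp only [smul_eq_mul] at hc
  dsimp only at hf hh hg hk
  have hR : 0 ≤ a * r + b * t := by positivity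
  have hS : a * s + b * u ≤ 2 * (a * h + b * k - V (a * r + b * t)) := by
    subst hh hk; linarith
  have hS0 : 0 ≤ a * s + b * u := by positivity
  have hfg : 2 * (f * g) ≤ r * u + t * s := by
    have h0 : 0 ≤ r * u + t * s := by positivity
    refine le_of_abs_le (abs_le_of_sq_le_sq ?_ h0)
    have h1 : f ^ 2 * g ^ 2 ≤ (r * s) * (t * u) :=
      mul_le_mul hf hg (sq_nonneg g) (mul_nonneg hr hs)
    nlinarith [sq_nonneg (r * u - t * s)]
  refine ⟨a * r + b * t, 2 * (a * h + b * k - V (a * r + b * t)), hR, hS0.trans hS, ?_, ?_⟩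
  · refine le_trans ?_ (mul_le_mul_of_nonneg_left hS hR)
    simp only [Prod.smul_mk, Prod.mk_add_mk, smul_eq_mul]
    nlinarith [mul_le_mul_of_nonneg_left hfg (mul_nonneg ha hb),
      mul_le_mul_of_nonneg_left hf (mul_nonneg ha ha),
      mul_le_mul_of_nonneg_left hg (mul_nonneg hb hb)]
  · simp only [Prod.smul_mk, Prod.mk_add_mk, smul_eq_mul]
    ring
end
end

section
/- Let V : [0, ∞) → ℝ be a smooth function with V(0) = 0 and V(r) > 0, V'(r) > 0, V''(r) ≥ 0 for all r > 0, and let g(z) := sup_{r ≥ 0} (r z − r V(r)). Then the image of the map ℝ⁴ → ℝ², (x, ξ) ↦ (x₁ξ₂ − x₂ξ₁, (ξ₁² + ξ₂²)/2 + V(x₁² + x₂²)), equals the set {(c, z) ∈ ℝ² : z ≥ 0 and c² ≤ 2 g(z)}. -/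
noncomputable section

/-- The image of `(x, ξ) ↦ (F(x,ξ), H(x,ξ))`, with `F = x₁ξ₂ - x₂ξ₁` and
`H = (ξ₁² + ξ₂²)/2 + V(x₁² + x₂²)`, is exactly
`{(c, z) : z ≥ 0 and c² ≤ 2 g(z)}` where `g` is the Legendre transform of
`r ↦ r V(r)`. -/
theorem stmt17 (V : ℝ → ℝ) (hV : ContDiffOn ℝ (⊤ : ℕ∞) V (Set.Ici 0))
    (hV0 : V 0 = 0)
    (hVpos : ∀ r > (0:ℝ), 0 < V r)
    (hV' : ∀ r > (0:ℝ), 0 < deriv V r)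
    (hV'' : ∀ r > (0:ℝ), 0 ≤ deriv (deriv V) r)
    (g : ℝ → ℝ)
    (hg : ∀ z, g z = sSup ((fun r => r * z - r * V r) '' Set.Ici 0)) :
    Set.range (fun q : ℝ × ℝ × ℝ × ℝ =>
      ((q.1 * q.2.2.2 - q.2.1 * q.2.2.1,
        (q.2.2.1 ^ 2 + q.2.2.2 ^ 2) / 2 + V (q.1 ^ 2 + q.2.1 ^ 2)) : ℝ × ℝ)) =
      {p : ℝ × ℝ | 0 ≤ p.2 ∧ p.1 ^ 2 ≤ 2 * g p.2} := by
  have hcont : ContinuousOn V (Set.Ici 0) := hV.continuousOn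
  have hVd : ContDiffOn ℝ (⊤ : ℕ∞) V (Set.Ioi 0) := hV.mono Set.Ioi_subset_Ici_self
  have hconv : ConvexOn ℝ (Set.Ici 0) V := by
    apply convexOn_of_deriv2_nonneg (convex_Ici 0) hcont
    · rw [interior_Ici]
      exact hVd.differentiableOn (by simp)
    · rw [interior_Ici]
      have h := ((contDiffOn_infty_iff_deriv_of_isOpen isOpen_Ioi).1 hVd).2
      exact h.differentiableOn (by simp)
    · intro x hx
      rw [interior_Ici] at hx
      exact hV'' x hx
  have hV1 : 0 < V 1 := hVpos 1 one_pos
  have hVnn : ∀ r, 0 ≤ r → 0 ≤ V r := by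
    intro r hr
    rcases hr.eq_or_lt with h | h
    · rw [← h, hV0]
    · exact (hVpos r h).le
  have hlin : ∀ r, 1 ≤ r → r * V 1 ≤ V r := by
    intro r hr
    have hr0 : 0 < r := by linarith
    have hi : r⁻¹ ≤ 1 := inv_le_one_of_one_le₀ hr
    have ha : (0:ℝ) ≤ r⁻¹ := by positivity
    have hb : (0:ℝ) ≤ 1 - r⁻¹ := by linarith
    have h := hconv.2 (Set.mem_Ici.2 hr0.le) (Set.mem_Ici.2 (le_refl (0:ℝ))) ha hb (by ring)
    simp only [smul_eq_mul, mul_zero, add_zero, hV0, inv_mul_cancel₀ hr0.ne'] at h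
    calc r * V 1 ≤ r * (r⁻¹ * V r) := by gcongr
      _ = V r := by field_simp
  have hmax : ∀ z, ∃ r0, 0 ≤ r0 ∧ ∀ r, 0 ≤ r → r * z - r * V r ≤ r0 * z - r0 * V r0 := by
    intro z
    have hR : (0:ℝ) ≤ max 1 (z / V 1) := le_trans zero_le_one (le_max_left _ _)
    obtain ⟨r0, hr0, hm⟩ := (isCompact_Icc (a := (0:ℝ)) (b := max 1 (z / V 1))).exists_isMaxOn
      ⟨0, le_refl _, hR⟩ (f := fun r => r * z - r * V r)
      ((continuousOn_id.mul continuousOn_const).sub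
        (continuousOn_id.mul (hcont.mono Set.Icc_subset_Ici_self)))
    refine ⟨r0, hr0.1, fun r hr => ?_⟩
    by_cases h : r ≤ max 1 (z / V 1)
    · exact hm ⟨hr, h⟩
    · have h0 : (0:ℝ) * z - 0 * V 0 ≤ r0 * z - r0 * V r0 := hm ⟨le_refl _, hR⟩
      have h1 := le_max_left 1 (z / V 1)
      have h2 := le_max_right 1 (z / V 1)
      push Not at h
      have h3 := hlin r (by linarith)
      have h4 : z ≤ r * V 1 := (div_le_iff₀ hV1).1 (by linarith)
      nlinarith [mul_nonneg hr (sub_nonneg.2 (h4.trans h3))]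
  ext ⟨c, z⟩
  simp only [Set.mem_range, Set.mem_setOf_eq, Prod.mk.injEq, Prod.exists]
  obtain ⟨r0, hr0, hm⟩ := hmax z
  have hgz : g z = r0 * z - r0 * V r0 := by
    rw [hg]
    apply IsGreatest.csSup_eq
    refine ⟨⟨r0, hr0, rfl⟩, ?_⟩
    rintro _ ⟨r, hr, rfl⟩
    exact hm r hr
  rw [hgz]
  constructor
  · rintro ⟨a, b, p, q, hc, hz⟩
    have hn : 0 ≤ a ^ 2 + b ^ 2 := by positivity
    refine ⟨?_, ?_⟩
    · have := hVnn _ hn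
      rw [← hz]; positivity
    · have h := hm _ hn
      have hz' : V (a ^ 2 + b ^ 2) = z - (p ^ 2 + q ^ 2) / 2 := by linarith
      rw [hz'] at h
      rw [← hc]
      nlinarith [sq_nonneg (a * p + b * q)]
  · rintro ⟨hz, hc⟩
    rcases hr0.eq_or_lt with h | h
    · subst h
      have hc0 : c = 0 := by
        have : c ^ 2 = 0 := le_antisymm (by linarith) (sq_nonneg c)
        exact pow_eq_zero_iff (two_ne_zero) |>.1 this
      refine ⟨0, 0, √(2 * z), 0, by simp [hc0], ?_⟩
      rw [Real.sq_sqrt (by linarith)]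
      simp [hV0]
    · have hs : 0 < √r0 := Real.sqrt_pos.2 h
      refine ⟨√r0, 0, √(2 * (z - V r0) - c ^ 2 / r0), c / √r0, by field_simp; ring, ?_⟩
      have h5 : c ^ 2 / r0 ≤ 2 * (z - V r0) := by
        rw [div_le_iff₀ h]; linarith
      rw [Real.sq_sqrt (by linarith), div_pow, Real.sq_sqrt hr0]
      simp only [ne_eq, OfNat.ofNat_ne_zero, not_false_eq_true, zero_pow, add_zero]
      ring
end
end
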